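/- Let V be a type, d : V → ℝ a demand function, and p = [v₁, …, v_k] (k ≥ 2) a list of distinct vertices. Define the updated demand function d' by d'(v₁) = d(v₁) + ∑_{i=2}^{k-1} d(v_i) and d'(x) = d(x) for x ≠ v₁. Let l₁, l₂ be lists of vertices such that the full route l₁ ++ p ++ l₂ has no duplicate vertices. Then the total demand of the aggregated route equals the total demand of the original route: ∑_{x ∈ l₁ ++ [v₁, v_k] ++ l₂} d'(x) = ∑_{x ∈ l₁ ++ p ++ l₂} d(x). In particular, the aggregated route satisfies the capacity constraint (total demand ≤ Q) if and only if the original route does. -/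

import Mathlib

/-- Network reduction preserves total route demand: replacing the duplicate-free
sequence `p = v₁ :: mid ++ [v_k]` by the pair `[v₁, v_k]`, with the demands of
the intermediate nodes added to `v₁`, leaves the total demand of a
duplicate-free route unchanged; in particular, the capacity constraint is
satisfied by the aggregated route iff it is satisfied by the original one. -/
theorem aggregated_route_demand {V : Type*} [DecidableEq V]
    (d : V → ℝ) (Q : ℝ) (v₁ vk : V) (mid l₁ l₂ : List V)
    (hpnodup : (v₁ :: (mid ++ [vk])).Nodup)
    (d' : V → ℝ)
    (hd' : d' = fun x => if x = v₁ then d v₁ + (mid.map d).sum else d x)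
    (hroute : (l₁ ++ (v₁ :: (mid ++ [vk])) ++ l₂).Nodup) :
    ((l₁ ++ [v₁, vk] ++ l₂).map d').sum =
        ((l₁ ++ (v₁ :: (mid ++ [vk])) ++ l₂).map d).sum ∧
      (((l₁ ++ [v₁, vk] ++ l₂).map d').sum ≤ Q ↔
        ((l₁ ++ (v₁ :: (mid ++ [vk])) ++ l₂).map d).sum ≤ Q) := by
  have map_eq : ∀ l : List V, v₁ ∉ l → l.map d' = l.map d := by
    intro l hl
    refine List.map_congr_left fun x hx => ?_
    have hne : x ≠ v₁ := fun h => hl (h ▸ hx)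
    simp [hd', hne]
  have hl₁ : v₁ ∉ l₁ := by
    intro h
    simp only [List.append_assoc] at hroute
    exact List.disjoint_of_nodup_append hroute h (by simp)
  have hl₂ : v₁ ∉ l₂ := fun h =>
    List.disjoint_of_nodup_append hroute (by simp) h
  have hvk : vk ≠ v₁ := by
    rintro rfl
    simp at hpnodup
  have hsum : ((l₁ ++ [v₁, vk] ++ l₂).map d').sum =
      ((l₁ ++ (v₁ :: (mid ++ [vk])) ++ l₂).map d).sum := by
    have h₁ : d' v₁ = d v₁ + (mid.map d).sum := by simp [hd']
    have hk : d' vk = d vk := by simp [hd', hvk]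
    simp only [List.map_append, List.sum_append, List.map_cons, List.map_nil,
      List.sum_cons, List.sum_nil, map_eq l₁ hl₁, map_eq l₂ hl₂, h₁, hk]
    ring
  exact ⟨hsum, by rw [hsum]⟩
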